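/- arXiv:1908.10704 — 2 statements merged into one kernel-verified Lean document; each statement's English description precedes it below -/
import Mathlib

section
/- Let Γ be a group, n a natural number, and ρ : Γ → SO(2n+1,ℂ) an irreducible representation. Suppose there exists P ∈ GL(2n+1,ℂ) such that P·ρ(γ)·P⁻¹ = conj(ρ(γ)) for all γ ∈ Γ. Then there exist natural numbers p, q with p + q = 2n+1 and a matrix Q ∈ SO(2n+1,ℂ) such that for all γ ∈ Γ the matrix D_{p,q}⁻¹·Q·ρ(γ)·Q⁻¹·D_{p,q} has real entries, determinant 1, and satisfies ᵀX·I_{p,q}·X = I_{p,q} (where X = D_{p,q}⁻¹·Q·ρ(γ)·Q⁻¹·D_{p,q}); that is, ρ is conjugate in SO(2n+1,ℂ) to a representation with values in the copy 𝒮𝒪_{p,q} = D_{p,q}·SO(p,q)·D_{p,q}⁻¹ of SO(p,q). -/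
open Matrix

noncomputable section

/-- `M ∈ O(m,ℂ)`, i.e. `ᵀM M = Iₘ`. -/
def IsOrthoC {m : ℕ} (M : Matrix (Fin m) (Fin m) ℂ) : Prop :=
  Mᵀ * M = 1

/-- The matrix `I_{p,q} = diag(I_p, −I_q)` (of size `m`, with `p + q = m`). -/
def Ipq (m p : ℕ) : Matrix (Fin m) (Fin m) ℂ :=
  Matrix.diagonal (fun i => if (i : ℕ) < p then 1 else -1)

/-- The matrix `D_{p,q} = diag(I_p, i·I_q)` (of size `m`, with `p + q = m`). -/
def Dpq (m p : ℕ) : Matrix (Fin m) (Fin m) ℂ :=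
  Matrix.diagonal (fun i => if (i : ℕ) < p then 1 else Complex.I)

/-- A representation `ρ : Γ → GL(n,ℂ)` is irreducible if the only invariant
subspaces of `ℂⁿ` are `{0}` and `ℂⁿ`. -/
def MatIrreducible {Γ : Type*} [Group Γ] {ι : Type*} [Fintype ι] [DecidableEq ι]
    (ρ : Γ →* Matrix.GeneralLinearGroup ι ℂ) : Prop :=
  ∀ W : Submodule ℂ (ι → ℂ),
    (∀ γ : Γ, ∀ x ∈ W, Matrix.mulVec (ρ γ : Matrix ι ι ℂ) x ∈ W) →
      W = ⊥ ∨ W = ⊤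

/-- Schur's lemma: a matrix commuting with an irreducible representation is scalar. -/
theorem MatIrreducible.exists_eq_smul_one {Γ : Type*} [Group Γ] {ι : Type*} [Fintype ι]
    [DecidableEq ι] [Nonempty ι] {ρ : Γ →* Matrix.GeneralLinearGroup ι ℂ}
    (hirr : MatIrreducible ρ) (M : Matrix ι ι ℂ)
    (hM : ∀ γ, M * (ρ γ : Matrix ι ι ℂ) = (ρ γ : Matrix ι ι ℂ) * M) :
    ∃ c : ℂ, M = c • (1 : Matrix ι ι ℂ) := by
  obtain ⟨c, hc⟩ := Module.End.exists_eigenvalue (Matrix.toLin' M)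
  refine ⟨c, ?_⟩
  have htop : Module.End.eigenspace (Matrix.toLin' M) c = ⊤ := by
    refine (hirr _ fun γ x hx => ?_).resolve_left hc
    rw [Module.End.mem_eigenspace_iff, Matrix.toLin'_apply] at hx ⊢
    rw [Matrix.mulVec_mulVec, hM, ← Matrix.mulVec_mulVec, hx, Matrix.mulVec_smul]
  apply Matrix.toLin'.injective
  refine LinearMap.ext fun v => ?_
  have hv : v ∈ Module.End.eigenspace (Matrix.toLin' M) c := htop ▸ Submodule.mem_top
  simpa using Module.End.mem_eigenspace_iff.1 hv

/-- A complex orthogonal matrix intertwining an irreducible orthogonal representation with its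
complex conjugate satisfies `conj P * P = 1` in odd dimension. -/
theorem MatIrreducible.conj_mul_self_eq_one {Γ : Type*} [Group Γ] {m : ℕ} (hm : Odd m)
    {ρ : Γ →* Matrix.GeneralLinearGroup (Fin m) ℂ} (hirr : MatIrreducible ρ)
    {P : Matrix (Fin m) (Fin m) ℂ} (hP : IsOrthoC P)
    (hconj : ∀ γ, P * (ρ γ : Matrix (Fin m) (Fin m) ℂ) =
      (ρ γ : Matrix (Fin m) (Fin m) ℂ).map (starRingEnd ℂ) * P) :
    P.map (starRingEnd ℂ) * P = 1 := by
  have : Nonempty (Fin m) := ⟨⟨0, hm.pos⟩⟩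
  have hbar : ∀ M : Matrix (Fin m) (Fin m) ℂ,
      (M.map (starRingEnd ℂ)).map (starRingEnd ℂ) = M := fun M => by ext; simp
  obtain ⟨c, hc⟩ := hirr.exists_eq_smul_one (P.map (starRingEnd ℂ) * P) fun γ => by
    have h := congrArg (fun M => M.map (starRingEnd ℂ)) (hconj γ)
    simp only [Matrix.map_mul, hbar] at h
    rw [mul_assoc, hconj, ← mul_assoc, h, mul_assoc]
  have hreal : (starRingEnd ℂ) c = c := by
    have h1 := congrArg (fun M => M.map (starRingEnd ℂ)) hc
    simp only [Matrix.map_mul, hbar] at h1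
    have h2 : P * P.map (starRingEnd ℂ) = c • (1 : Matrix (Fin m) (Fin m) ℂ) := by
      calc P * P.map (starRingEnd ℂ)
          = P * (P.map (starRingEnd ℂ) * P) * Pᵀ := by
            rw [mul_assoc, mul_assoc, mul_eq_one_comm.1 hP, mul_one]
        _ = _ := by rw [hc]; simp [mul_eq_one_comm.1 hP]
    have h3 := congrFun (congrFun (h1.symm.trans h2) ⟨0, hm.pos⟩) ⟨0, hm.pos⟩
    simpa using h3
  obtain ⟨r, rfl⟩ := Complex.conj_eq_iff_real.1 hreal
  have hdet : P.det * P.det = 1 := by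
    simpa [IsOrthoC] using congrArg Matrix.det hP
  have hpow : (r : ℂ) ^ m = 1 := by
    have h := congrArg Matrix.det hc
    rw [Matrix.det_mul, Matrix.det_smul, Matrix.det_one, ← RingHom.mapMatrix_apply,
      ← RingHom.map_det] at h
    rcases mul_self_eq_one_iff.1 hdet with hd | hd <;> simpa [hd] using h.symm
  have hr : r = 1 := by
    have : r ^ m = 1 ^ m := by rw [one_pow]; exact_mod_cast hpow
    exact hm.strictMono_pow.injective this
  simpa [hr] using hc

/-- An intertwiner between an irreducible orthogonal representation and its complex conjugate can
be rescaled to a complex orthogonal matrix. -/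
theorem MatIrreducible.exists_isOrthoC_intertwiner {Γ : Type*} [Group Γ] {m : ℕ} [NeZero m]
    {ρ : Γ →* Matrix.GeneralLinearGroup (Fin m) ℂ} (hirr : MatIrreducible ρ)
    (ho : ∀ γ, IsOrthoC (ρ γ : Matrix (Fin m) (Fin m) ℂ))
    {P : Matrix (Fin m) (Fin m) ℂ} (hP : IsUnit P)
    (hconj : ∀ γ, P * (ρ γ : Matrix (Fin m) (Fin m) ℂ) =
      (ρ γ : Matrix (Fin m) (Fin m) ℂ).map (starRingEnd ℂ) * P) :
    ∃ R : Matrix (Fin m) (Fin m) ℂ, IsOrthoC R ∧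
      ∀ γ, R * (ρ γ : Matrix (Fin m) (Fin m) ℂ) =
        (ρ γ : Matrix (Fin m) (Fin m) ℂ).map (starRingEnd ℂ) * R := by
  obtain ⟨c, hc⟩ := hirr.exists_eq_smul_one (Pᵀ * P) fun γ => by
    have hA : (ρ γ : Matrix (Fin m) (Fin m) ℂ) * (ρ γ : Matrix (Fin m) (Fin m) ℂ)ᵀ = 1 :=
      mul_eq_one_comm.1 (ho γ)
    have hB : ((ρ γ : Matrix (Fin m) (Fin m) ℂ).map (starRingEnd ℂ))ᵀ *
        (ρ γ : Matrix (Fin m) (Fin m) ℂ).map (starRingEnd ℂ) = 1 := by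
      rw [← Matrix.transpose_map, ← Matrix.map_mul, ho γ]
      exact Matrix.map_one _ (map_zero _) (map_one _)
    have hT := congrArg Matrix.transpose (hconj γ)
    simp only [Matrix.transpose_mul] at hT
    set A := (ρ γ : Matrix (Fin m) (Fin m) ℂ)
    set B := A.map (starRingEnd ℂ)
    calc Pᵀ * P * A = A * (Aᵀ * Pᵀ) * B * P := by
          rw [← mul_assoc A, hA, one_mul, mul_assoc, hconj, mul_assoc]
      _ = A * (Pᵀ * P) := by
          rw [hT, mul_assoc A, mul_assoc Pᵀ, hB, mul_one, mul_assoc]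
  obtain ⟨d, hd⟩ := IsAlgClosed.exists_pow_nat_eq c (n := 2) two_pos
  have hd0 : d ≠ 0 := by
    rintro rfl
    have hu : IsUnit (Pᵀ * P) := ((Matrix.isUnit_transpose P).2 hP).mul hP
    rw [hc, ← hd] at hu
    simp at hu
  refine ⟨d⁻¹ • P, ?_, fun γ => by simp [hconj]⟩
  rw [IsOrthoC, Matrix.transpose_smul, Matrix.smul_mul, Matrix.mul_smul, hc, ← hd, smul_smul,
    smul_smul]
  convert one_smul ℂ _
  field_simp

open scoped ComplexOrder in
/-- A real structure `v ↦ conj (P v)` with `P` complex orthogonal has a basis of fixed vectors. -/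
theorem IsOrthoC.exists_isUnit_mul_eq_conj {m : ℕ} {P : Matrix (Fin m) (Fin m) ℂ}
    (hP : IsOrthoC P) (hPP : P.map (starRingEnd ℂ) * P = 1) :
    ∃ S : Matrix (Fin m) (Fin m) ℂ, IsUnit S ∧ P * S = S.map (starRingEnd ℂ) := by
  have hH : P.map (starRingEnd ℂ) = Pᵀ := by
    calc P.map (starRingEnd ℂ) = P.map (starRingEnd ℂ) * (P * Pᵀ) := by
          rw [mul_eq_one_comm.1 hP, mul_one]
      _ = Pᵀ := by rw [← mul_assoc, hPP, one_mul]
  have hU : IsUnit (Complex.I • (1 : Matrix (Fin m) (Fin m) ℂ) + P.map (starRingEnd ℂ)) := by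
    have hpos : (1 + P.map (starRingEnd ℂ) * (P.map (starRingEnd ℂ))ᴴ).PosDef :=
      Matrix.PosDef.one.add_posSemidef (Matrix.posSemidef_self_mul_conjTranspose _)
    have hs : (P.map (starRingEnd ℂ))ᴴ = P.map (starRingEnd ℂ) := by
      rw [hH]
      ext i j
      simpa using congrFun (congrFun hH i) j
    rw [hs] at hpos
    have hfac : (Complex.I • (1 : Matrix (Fin m) (Fin m) ℂ) + P.map (starRingEnd ℂ)) *
        (-Complex.I • (1 : Matrix (Fin m) (Fin m) ℂ) + P.map (starRingEnd ℂ)) =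
        1 + P.map (starRingEnd ℂ) * P.map (starRingEnd ℂ) := by
      simp [mul_add, add_mul, smul_smul]
      abel
    have h := hfac ▸ hpos.isUnit
    rw [Matrix.isUnit_iff_isUnit_det, Matrix.det_mul] at h
    exact (Matrix.isUnit_iff_isUnit_det _).2 (isUnit_of_mul_isUnit_left h)
  refine ⟨(1 - Complex.I) • (Complex.I • (1 : Matrix (Fin m) (Fin m) ℂ) +
    P.map (starRingEnd ℂ)), ?_, ?_⟩
  · have h0 : (1 - Complex.I) ≠ 0 := fun h => by simpa using congrArg Complex.re h
    exact hU.smul (Units.mk0 _ h0)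
  · rw [Matrix.mul_smul, mul_add, mul_eq_one_comm.1 hPP]
    ext i j
    by_cases hij : i = j
    · simp [hij]
      ring_nf
      simp
      ring
    · simp [hij]
      ring_nf
      simp

/-- Sylvester's law for a nondegenerate real symmetric matrix. -/
theorem Matrix.IsSymm.exists_transpose_mul_mul_eq_diagonal {m : ℕ}
    {G : Matrix (Fin m) (Fin m) ℝ} (hG : G.IsSymm) (hdet : G.det ≠ 0) :
    ∃ p ≤ m, ∃ R : Matrix (Fin m) (Fin m) ℝ,
      Rᵀ * G * R = Matrix.diagonal fun i : Fin m => if (i : ℕ) < p then 1 else -1 := by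
  have hH : G.IsHermitian := by
    rw [Matrix.IsHermitian, Matrix.conjTranspose_eq_transpose_of_trivial, hG]
  set d := hH.eigenvalues
  set U : Matrix (Fin m) (Fin m) ℝ := hH.eigenvectorUnitary.1
  have hd : ∀ i, d i ≠ 0 := by
    have h := hH.det_eq_prod_eigenvalues
    intro i hi
    exact hdet (h.trans (Finset.prod_eq_zero (Finset.mem_univ i) (by simpa using hi)))
  have hU : Uᵀ * G * U = Matrix.diagonal d := by
    have h := hH.conjStarAlgAut_star_eigenvectorUnitary
    rw [Unitary.conjStarAlgAut_star_apply] at h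
    exact h
  have hcard : Fintype.card {i // 0 < d i} ≤ m := by
    simpa using Fintype.card_subtype_le fun i => 0 < d i
  obtain ⟨e⟩ : Nonempty ({i : Fin m // (i : ℕ) < Fintype.card {i // 0 < d i}} ≃
      {i // 0 < d i}) := by
    rw [← Fintype.card_eq, Fintype.card_fin_lt_of_le hcard]
  set σ := e.extendSubtype
  refine ⟨_, hcard, (U * Matrix.diagonal fun i => (√|d i|)⁻¹).submatrix id σ, ?_⟩
  have hdiag : (U * Matrix.diagonal fun i => (√|d i|)⁻¹)ᵀ * G *
      (U * Matrix.diagonal fun i => (√|d i|)⁻¹) =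
      Matrix.diagonal fun i => if 0 < d i then 1 else -1 := by
    rw [Matrix.transpose_mul, Matrix.diagonal_transpose]
    calc _ = Matrix.diagonal (fun i => (√|d i|)⁻¹) * (Uᵀ * G * U) *
          Matrix.diagonal (fun i => (√|d i|)⁻¹) := by simp only [mul_assoc]
      _ = _ := by
        rw [hU, Matrix.diagonal_mul_diagonal, Matrix.diagonal_mul_diagonal]
        congr 1
        ext i
        have hs : √|d i| * √|d i| = |d i| := Real.mul_self_sqrt (abs_nonneg _)
        have h0 : √|d i| ≠ 0 := (Real.sqrt_pos.2 (abs_pos.2 (hd i))).ne'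
        split_ifs with h
        · rw [abs_of_pos h] at *
          field_simp
          linarith
        · rw [abs_of_nonpos (not_lt.1 h)] at *
          field_simp
          linarith
  calc _ = ((U * Matrix.diagonal fun i => (√|d i|)⁻¹)ᵀ * G *
        (U * Matrix.diagonal fun i => (√|d i|)⁻¹)).submatrix σ σ := by
        ext i j
        simp [Matrix.mul_apply]
    _ = _ := by
      rw [hdiag, Matrix.submatrix_diagonal _ _ σ.injective]
      congr 1
      ext i
      have h : 0 < d (σ i) ↔ (i : ℕ) < Fintype.card {i // 0 < d i} :=
        ⟨fun h => by_contra fun h' => e.extendSubtype_not_mem i h' h, e.extendSubtype_mem i⟩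
      simp [h]

theorem Dpq_mul_self (m p : ℕ) : Dpq m p * Dpq m p = Ipq m p := by
  rw [Dpq, Ipq, Matrix.diagonal_mul_diagonal]
  congr 1
  ext i
  split_ifs <;> simp

theorem Ipq_mul_self (m p : ℕ) : Ipq m p * Ipq m p = 1 := by
  rw [Ipq, Matrix.diagonal_mul_diagonal, ← Matrix.diagonal_one]
  congr 1
  ext i
  split_ifs <;> simp

/-- The real structure `v ↦ conj (P v)` has a basis of fixed vectors which is orthonormal, up to
signs, for the standard bilinear form. -/
theorem IsOrthoC.exists_transpose_mul_self_eq_Ipq {m : ℕ} {P : Matrix (Fin m) (Fin m) ℂ}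
    (hP : IsOrthoC P) (hPP : P.map (starRingEnd ℂ) * P = 1) :
    ∃ p ≤ m, ∃ T : Matrix (Fin m) (Fin m) ℂ,
      Tᵀ * T = Ipq m p ∧ P * T = T.map (starRingEnd ℂ) := by
  obtain ⟨S, hS, hPS⟩ := hP.exists_isUnit_mul_eq_conj hPP
  have hreal : (Sᵀ * S).map (starRingEnd ℂ) = Sᵀ * S := by
    rw [Matrix.map_mul, Matrix.transpose_map, ← hPS, Matrix.transpose_mul, mul_assoc,
      ← mul_assoc Pᵀ, hP, one_mul]
  set G : Matrix (Fin m) (Fin m) ℝ := (Sᵀ * S).map Complex.re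
  have hG : G.map Complex.ofRealHom = Sᵀ * S := by
    ext i j
    exact Complex.conj_eq_iff_re.1 (congrFun (congrFun hreal i) j)
  have hsymm : G.IsSymm := by
    rw [Matrix.IsSymm, ← Matrix.transpose_map, Matrix.transpose_mul, Matrix.transpose_transpose]
  have hdet : G.det ≠ 0 := fun h => by
    have h1 := ((Matrix.isUnit_transpose S).2 hS).mul hS
    rw [← hG, Matrix.isUnit_iff_isUnit_det, ← RingHom.mapMatrix_apply, ← RingHom.map_det, h] at h1
    simp at h1
  obtain ⟨p, hp, R, hR⟩ := hsymm.exists_transpose_mul_mul_eq_diagonal hdet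
  refine ⟨p, hp, S * R.map Complex.ofRealHom, ?_, ?_⟩
  · calc _ = (R.map Complex.ofRealHom)ᵀ * (Sᵀ * S) * R.map Complex.ofRealHom := by
          simp only [Matrix.transpose_mul, mul_assoc]
      _ = (Rᵀ * G * R).map Complex.ofRealHom := by
          rw [Matrix.map_mul, Matrix.map_mul, hG, Matrix.transpose_map]
      _ = Ipq m p := by
          rw [hR, Ipq, Matrix.diagonal_map (map_zero _)]
          congr 1
          ext i
          split_ifs <;> simp
  · rw [← mul_assoc, hPS, Matrix.map_mul]
    congr 1
    ext i j
    simp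

/-- An irreducible odd-dimensional representation into `SO(m, ℂ)` which is equivalent to its complex
conjugate is conjugate in `SO(m, ℂ)` to a representation into a copy of some `SO(p, q)`. -/
theorem MatIrreducible.exists_conj_mem_SOpq {Γ : Type*} [Group Γ] {m : ℕ} (hodd : Odd m)
    {ρ : Γ →* Matrix.GeneralLinearGroup (Fin m) ℂ}
    (ho : ∀ γ : Γ, IsOrthoC (ρ γ : Matrix (Fin m) (Fin m) ℂ))
    (hdet : ∀ γ : Γ, (ρ γ : Matrix (Fin m) (Fin m) ℂ).det = 1)
    (hirr : MatIrreducible ρ)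
    {P : Matrix (Fin m) (Fin m) ℂ} (hP : IsUnit P)
    (hconj : ∀ γ : Γ,
      P * (ρ γ : Matrix (Fin m) (Fin m) ℂ) * P⁻¹
        = (ρ γ : Matrix (Fin m) (Fin m) ℂ).map (starRingEnd ℂ)) :
    ∃ p q : ℕ, p + q = m ∧
      ∃ Q : Matrix (Fin m) (Fin m) ℂ, IsOrthoC Q ∧ Q.det = 1 ∧
        ∀ γ : Γ,
          ((Dpq m p)⁻¹ * Q * (ρ γ : Matrix (Fin m) (Fin m) ℂ)
              * Q⁻¹ * Dpq m p).map (starRingEnd ℂ)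
            = (Dpq m p)⁻¹ * Q * (ρ γ : Matrix (Fin m) (Fin m) ℂ)
              * Q⁻¹ * Dpq m p ∧
          ((Dpq m p)⁻¹ * Q * (ρ γ : Matrix (Fin m) (Fin m) ℂ)
              * Q⁻¹ * Dpq m p).det = 1 ∧
          ((Dpq m p)⁻¹ * Q * (ρ γ : Matrix (Fin m) (Fin m) ℂ)
              * Q⁻¹ * Dpq m p)ᵀ * Ipq m p *
            ((Dpq m p)⁻¹ * Q * (ρ γ : Matrix (Fin m) (Fin m) ℂ)
              * Q⁻¹ * Dpq m p)
            = Ipq m p := by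
  have : NeZero m := ⟨hodd.pos.ne'⟩
  have hdetP : IsUnit P.det := (Matrix.isUnit_iff_isUnit_det P).1 hP
  obtain ⟨R, hR, hRconj⟩ := hirr.exists_isOrthoC_intertwiner ho hP fun γ => by
    rw [← hconj γ, mul_assoc, Matrix.nonsing_inv_mul _ hdetP, mul_one]
  have hRR := hirr.conj_mul_self_eq_one hodd hR hRconj
  obtain ⟨p, hp, T, hT, hdet', hRT⟩ : ∃ p ≤ m,
      ∃ T : Matrix (Fin m) (Fin m) ℂ, Tᵀ * T = Ipq m p ∧
        T.det = (Dpq m p).det ∧ R * T = T.map (starRingEnd ℂ) := by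
    obtain ⟨p, hp, T, hT, hRT⟩ := hR.exists_transpose_mul_self_eq_Ipq hRR
    have hsq : T.det * T.det = (Dpq m p).det * (Dpq m p).det := by
      simpa using congrArg Matrix.det (hT.trans (Dpq_mul_self _ p).symm)
    rcases mul_self_eq_mul_self_iff.1 hsq with h | h
    · exact ⟨p, hp, T, hT, h, hRT⟩
    · refine ⟨p, hp, -T, by simpa using hT, by simp [Matrix.det_neg, hodd.neg_one_pow, h], ?_⟩
      rw [mul_neg, hRT]
      ext i j
      simp
  have hIu : IsUnit (Ipq m p).det := by
    have h := congrArg Matrix.det (Ipq_mul_self m p)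
    rw [Matrix.det_mul, Matrix.det_one] at h
    exact IsUnit.of_mul_eq_one _ h
  have hDu : IsUnit (Dpq m p).det := by
    rw [← Dpq_mul_self, Matrix.det_mul] at hIu
    exact isUnit_of_mul_isUnit_left hIu
  have hTu : IsUnit T.det := hdet' ▸ hDu
  have hDt : (Dpq m p)ᵀ = Dpq m p := Matrix.diagonal_transpose _
  refine ⟨p, m - p, Nat.add_sub_cancel' hp, Dpq m p * T⁻¹, ?_, ?_, fun γ => ?_⟩
  · rw [IsOrthoC, Matrix.transpose_mul, hDt, mul_assoc, ← mul_assoc (Dpq m p), Dpq_mul_self, ← hT,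
      mul_assoc Tᵀ, Matrix.mul_nonsing_inv _ hTu, mul_one, ← Matrix.transpose_mul,
      Matrix.mul_nonsing_inv _ hTu, Matrix.transpose_one]
  · rw [Matrix.det_mul, ← hdet', ← Matrix.det_mul, Matrix.mul_nonsing_inv _ hTu, Matrix.det_one]
  · have hA := ho γ
    have hdA := hdet γ
    have hc := hRconj γ
    set A := (ρ γ : Matrix (Fin m) (Fin m) ℂ)
    have hX : (Dpq m p)⁻¹ * (Dpq m p * T⁻¹) * A * (Dpq m p * T⁻¹)⁻¹ * Dpq m p = T⁻¹ * A * T := by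
      rw [Matrix.nonsing_inv_mul_cancel_left _ _ hDu, Matrix.mul_inv_rev,
        Matrix.nonsing_inv_nonsing_inv _ hTu, ← mul_assoc, mul_assoc _ (Dpq m p)⁻¹,
        Matrix.nonsing_inv_mul _ hDu, mul_one]
    have hTX : T * (T⁻¹ * A * T) = A * T := by
      rw [mul_assoc, Matrix.mul_nonsing_inv_cancel_left _ _ hTu]
    rw [hX]
    refine ⟨?_, ?_, ?_⟩
    · have hRu : IsUnit R.det := by
        rw [← Matrix.isUnit_iff_isUnit_det]
        exact IsUnit.of_mul_eq_one_right _ hR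
      have hRTu : IsUnit (R * T).det := by
        rw [Matrix.det_mul]
        exact hRu.mul hTu
      have key : R * T * (T⁻¹ * A * T).map (starRingEnd ℂ) = R * T * (T⁻¹ * A * T) := by
        rw [mul_assoc R T (T⁻¹ * A * T), hTX, ← mul_assoc R, hc, mul_assoc _ R T, hRT,
          ← Matrix.map_mul, hTX, Matrix.map_mul]
      exact ((Matrix.isUnit_iff_isUnit_det _).2 hRTu).mul_left_cancel key
    · rw [Matrix.det_mul, Matrix.det_mul, hdA, mul_one, ← Matrix.det_mul,
        Matrix.nonsing_inv_mul _ hTu, Matrix.det_one]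
    · calc _ = (T * (T⁻¹ * A * T))ᵀ * (T * (T⁻¹ * A * T)) := by
            rw [Matrix.transpose_mul T, ← hT]
            simp only [mul_assoc]
        _ = Tᵀ * (Aᵀ * A) * T := by
            rw [hTX, Matrix.transpose_mul]
            simp only [mul_assoc]
        _ = _ := by rw [hA, mul_one, hT]

theorem stmt8 {Γ : Type*} [Group Γ] (n : ℕ)
    (ρ : Γ →* Matrix.GeneralLinearGroup (Fin (2 * n + 1)) ℂ)
    (ho : ∀ γ : Γ, IsOrthoC (ρ γ : Matrix (Fin (2 * n + 1)) (Fin (2 * n + 1)) ℂ))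
    (hdet : ∀ γ : Γ, (ρ γ : Matrix (Fin (2 * n + 1)) (Fin (2 * n + 1)) ℂ).det = 1)
    (hirr : MatIrreducible ρ)
    (P : Matrix (Fin (2 * n + 1)) (Fin (2 * n + 1)) ℂ) (hP : IsUnit P)
    (hconj : ∀ γ : Γ,
      P * (ρ γ : Matrix (Fin (2 * n + 1)) (Fin (2 * n + 1)) ℂ) * P⁻¹
        = (ρ γ : Matrix (Fin (2 * n + 1)) (Fin (2 * n + 1)) ℂ).map (starRingEnd ℂ)) :
    ∃ p q : ℕ, p + q = 2 * n + 1 ∧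
      ∃ Q : Matrix (Fin (2 * n + 1)) (Fin (2 * n + 1)) ℂ, IsOrthoC Q ∧ Q.det = 1 ∧
        ∀ γ : Γ,
          ((Dpq (2 * n + 1) p)⁻¹ * Q * (ρ γ : Matrix (Fin (2 * n + 1)) (Fin (2 * n + 1)) ℂ)
              * Q⁻¹ * Dpq (2 * n + 1) p).map (starRingEnd ℂ)
            = (Dpq (2 * n + 1) p)⁻¹ * Q * (ρ γ : Matrix (Fin (2 * n + 1)) (Fin (2 * n + 1)) ℂ)
              * Q⁻¹ * Dpq (2 * n + 1) p ∧
          ((Dpq (2 * n + 1) p)⁻¹ * Q * (ρ γ : Matrix (Fin (2 * n + 1)) (Fin (2 * n + 1)) ℂ)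
              * Q⁻¹ * Dpq (2 * n + 1) p).det = 1 ∧
          ((Dpq (2 * n + 1) p)⁻¹ * Q * (ρ γ : Matrix (Fin (2 * n + 1)) (Fin (2 * n + 1)) ℂ)
              * Q⁻¹ * Dpq (2 * n + 1) p)ᵀ * Ipq (2 * n + 1) p *
            ((Dpq (2 * n + 1) p)⁻¹ * Q * (ρ γ : Matrix (Fin (2 * n + 1)) (Fin (2 * n + 1)) ℂ)
              * Q⁻¹ * Dpq (2 * n + 1) p)
            = Ipq (2 * n + 1) p := by
  exact hirr.exists_conj_mem_SOpq (odd_two_mul_add_one n) ho hdet hP hconj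
end
end

section
/- Let Γ be a group, n a positive integer, and ρ : Γ → GL(n,ℂ) a semisimple representation. Suppose there exists P ∈ GL(n,ℂ) such that P·ρ(γ)·P⁻¹ = conj(ρ(γ)) for all γ ∈ Γ. Then there exist natural numbers r₁, r₂ with r₁ + 2r₂ = n and a matrix Q ∈ GL(n,ℂ) such that for every γ ∈ Γ the matrix Q·ρ(γ)·Q⁻¹ is block-diagonal, equal to diag(A(γ), B(γ)), where A(γ) is an invertible r₁×r₁ matrix with real entries and B(γ) is an invertible 2r₂×2r₂ complex matrix satisfying B(γ)·J_{2r₂} = J_{2r₂}·conj(B(γ)); that is, ρ is conjugate to the direct sum of a representation with values in GL(r₁,ℝ) and a representation with values in GL(r₂,ℍ). -/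
open Matrix

noncomputable section

/-- The standard symplectic matrix `J_{2m} = [[0, Iₘ],[−Iₘ, 0]]`. -/
def Jmat (m : ℕ) : Matrix (Fin m ⊕ Fin m) (Fin m ⊕ Fin m) ℂ :=
  Matrix.fromBlocks 0 1 (-1) 0

/-- A representation `ρ : Γ → GL(n,ℂ)` is semisimple if every invariant subspace
of `ℂⁿ` admits an invariant complement. -/
def MatSemisimple {Γ : Type*} [Group Γ] {ι : Type*} [Fintype ι] [DecidableEq ι]
    (ρ : Γ →* Matrix.GeneralLinearGroup ι ℂ) : Prop :=
  ∀ W : Submodule ℂ (ι → ℂ),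
    (∀ γ : Γ, ∀ x ∈ W, Matrix.mulVec (ρ γ : Matrix ι ι ℂ) x ∈ W) →
      ∃ W' : Submodule ℂ (ι → ℂ),
        (∀ γ : Γ, ∀ x ∈ W', Matrix.mulVec (ρ γ : Matrix ι ι ℂ) x ∈ W') ∧ IsCompl W W'

section

open Polynomial ComplexConjugate

theorem isNilpotent_aeval_of_forall_mem_spectrum {ι : Type*} [Fintype ι] [DecidableEq ι]
    (X : Matrix ι ι ℂ) (f : ℂ[X]) (hf : ∀ z ∈ spectrum ℂ X, f.eval z = 0) :
    IsNilpotent (aeval X f) := by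
  have hsplit : X.charpoly.Splits := IsAlgClosed.splits _
  have hdvd : X.charpoly ∣ f ^ X.charpoly.roots.card := by
    have h : (X.charpoly.roots.map (Polynomial.X - C ·)).prod ∣
        (X.charpoly.roots.map fun _ ↦ f).prod := by
      refine Multiset.prod_dvd_prod_of_dvd _ _ fun a ha ↦ dvd_iff_isRoot.2 (hf a ?_)
      rw [Matrix.mem_spectrum_iff_isRoot_charpoly]
      exact isRoot_of_mem_roots ha
    rwa [← hsplit.eq_prod_roots_of_monic X.charpoly_monic, Multiset.map_const',
      Multiset.prod_replicate] at h
  refine ⟨X.charpoly.roots.card, ?_⟩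
  obtain ⟨g, hg⟩ := hdvd
  rw [← map_pow, hg, map_mul, Matrix.aeval_self_charpoly, zero_mul]

theorem exists_conj_equivariant_pow_four_eq_sq :
    ∃ c : ℂ → ℂ, (∀ z, c (conj z) = conj (c z)) ∧ ∀ z, c z ^ 4 = z ^ 2 := by
  classical
  refine ⟨fun z ↦ if z.arg = Real.pi then (√|z.re| : ℝ) else z ^ (1 / 2 : ℂ),
    fun z ↦ ?_, fun z ↦ ?_⟩
  · dsimp only
    split_ifs with h₁ h₂ h₂
    · simp
    · rw [Complex.arg_conj] at h₁
      split_ifs at h₁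
      exact absurd (by linarith) (Complex.neg_pi_lt_arg z).ne
    · rw [Complex.arg_conj, if_pos h₂] at h₁
      exact absurd rfl h₁
    · rw [Complex.conj_cpow _ _ h₂, map_div₀, map_one, Complex.conj_ofNat]
  · dsimp only
    split_ifs with h
    · obtain ⟨h₁, h₂⟩ := Complex.arg_eq_pi_iff.1 h
      have hz : z = (z.re : ℂ) := Complex.ext rfl (by simpa using h₂)
      rw [hz, Complex.ofReal_re, ← Complex.ofReal_pow, ← Complex.ofReal_pow,
        show 4 = 2 * 2 from rfl, pow_mul, Real.sq_sqrt (abs_nonneg _), sq_abs]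
    · rw [← Complex.cpow_nat_mul, ← Complex.cpow_natCast]
      norm_num

theorem exists_real_polynomial_eval_eq (s : Finset ℂ) (c : ℂ → ℂ)
    (hc : ∀ z, c (conj z) = conj (c z)) :
    ∃ p : ℝ[X], ∀ z ∈ s, aeval z p = c z := by
  classical
  set t := s ∪ s.image conj with ht
  set q := Lagrange.interpolate t id c with hq
  have hqt : ∀ z ∈ t, q.eval z = c z := fun z hz ↦
    Lagrange.eval_interpolate_at_node c (Function.injective_id.injOn) hz
  have hlift : C (1 / 2) * (q + q.map (starRingEnd ℂ)) ∈ lifts (algebraMap ℝ ℂ) := by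
    rw [lifts_iff_coeff_lifts]
    intro n
    refine ⟨(q.coeff n).re, ?_⟩
    rw [coeff_C_mul, coeff_add, coeff_map, Complex.add_conj]
    simp
  obtain ⟨p, hp⟩ := (mem_lifts _).1 hlift
  refine ⟨p, fun z hz ↦ ?_⟩
  have hz₁ : z ∈ t := Finset.mem_union_left _ hz
  have hz₂ : conj z ∈ t := Finset.mem_union_right _ (Finset.mem_image_of_mem _ hz)
  have h : (q.map (starRingEnd ℂ)).eval z = c z := by
    have := eval₂_hom (p := q) (starRingEnd ℂ) (conj z)
    rw [Complex.conj_conj, hqt _ hz₂, hc, Complex.conj_conj] at this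
    rw [eval_map, this]
  rw [← aeval_map_algebraMap ℂ, hp, coe_aeval_eq_eval, eval_mul, eval_add, h, hqt z hz₁, eval_C]
  ring

theorem exists_mem_adjoin_pow_four_eq_sq {ι : Type*} [Fintype ι] [DecidableEq ι]
    (X : Matrix ι ι ℂ) (hX : IsUnit X) :
    ∃ b ∈ Algebra.adjoin ℝ {X}, b ^ 4 = X ^ 2 := by
  obtain ⟨c, hc, hc4⟩ := exists_conj_equivariant_pow_four_eq_sq
  have hfin : (spectrum ℂ X).Finite := X.finite_spectrum
  obtain ⟨p, hp⟩ := exists_real_polynomial_eval_eq hfin.toFinset c hc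
  have : IsMulCommutative (Algebra.adjoin ℝ {X}) := Algebra.isMulCommutative_adjoin ℝ (by simp)
  let : CommRing (Algebra.adjoin ℝ {X}) := inferInstance
  let x : Algebra.adjoin ℝ {X} := ⟨X, Algebra.self_mem_adjoin_singleton ℝ X⟩
  let y := aeval x p
  have hnil : IsNilpotent (y ^ 4 - x ^ 2) := by
    rw [← IsNilpotent.map_iff (f := (Algebra.adjoin ℝ {X}).val) Subtype.val_injective]
    have : (Algebra.adjoin ℝ {X}).val (y ^ 4 - x ^ 2) =
        aeval X ((p ^ 4 - Polynomial.X ^ 2).map (algebraMap ℝ ℂ)) := by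
      rw [aeval_map_algebraMap]
      simp [y, x]
    rw [this]
    refine isNilpotent_aeval_of_forall_mem_spectrum X _ fun z hz ↦ ?_
    rw [eval_map_algebraMap]
    simp [hp z (by simpa using hz), hc4]
  have hx : IsUnit x := by
    have : IsArtinianRing (Algebra.adjoin ℝ {X}) := IsArtinianRing.of_finite ℝ _
    refine IsArtinianRing.isUnit_of_mem_nonZeroDivisors
      (mem_nonZeroDivisors_iff_right.2 fun w hw ↦ ?_)
    exact Subtype.ext (hX.mul_left_eq_zero.1 (congrArg Subtype.val hw))
  have hy : IsUnit y := by
    rw [← isUnit_pow_iff four_ne_zero, ← add_sub_cancel (x ^ 2) (y ^ 4)]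
    exact hnil.isUnit_add_left_of_commute (hx.pow 2) (Commute.all _ _)
  obtain ⟨r, ⟨-, hr⟩, -⟩ := existsUnique_nilpotent_sub_and_aeval_eq_zero
    (P := (Polynomial.X ^ 4 - C (x ^ 2) : (Algebra.adjoin ℝ {X})[X])) (x := y)
    (by simpa using hnil)
    (by
      have h4 : IsUnit (4 : Algebra.adjoin ℝ {X}) := by
        rw [← map_ofNat (algebraMap ℝ (Algebra.adjoin ℝ {X})) 4]
        exact (isUnit_iff_ne_zero.2 (four_ne_zero (α := ℝ))).map _
      rw [derivative_sub, derivative_C, sub_zero, derivative_X_pow]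
      simpa using h4.mul (hy.pow 3))
  refine ⟨r, r.2, ?_⟩
  have : r ^ 4 = x ^ 2 := by simpa [sub_eq_zero] using hr
  exact congrArg Subtype.val this

section Antilinear

variable {V : Type*} [AddCommGroup V] [Module ℂ V] (T : V →ₛₗ[starRingEnd ℂ] V)

theorem mem_span_fixedPoints_of_apply_apply_eq {x : V} (hx : T (T x) = x) :
    x ∈ Submodule.span ℂ {v | T v = v} := by
  have h₁ : x + T x ∈ Submodule.span ℂ {v | T v = v} :=
    Submodule.subset_span (by simp [hx, add_comm])
  have h₂ : Complex.I • (x - T x) ∈ Submodule.span ℂ {v | T v = v} :=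
    Submodule.subset_span (by simp [hx, ← smul_neg])
  have h : x = (1 / 2 : ℂ) • (x + T x) + (-Complex.I / 2) • Complex.I • (x - T x) := by
    rw [smul_smul, show -Complex.I / 2 * Complex.I = 1 / 2 by
      linear_combination (-1 / 2 : ℂ) * Complex.I_mul_I]
    module
  rw [h]
  exact add_mem (Submodule.smul_mem _ _ h₁) (Submodule.smul_mem _ _ h₂)

theorem exists_linearIndependent_fixed [FiniteDimensional ℂ V] (W : Submodule ℂ V)
    (hW : ∀ x, x ∈ W ↔ T (T x) = x) :
    ∃ (r : ℕ) (v : Fin r → V), (∀ i, T (v i) = v i) ∧ LinearIndependent ℂ v ∧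
      Submodule.span ℂ (Set.range v) = W := by
  obtain ⟨b, hb, hspan, hli⟩ := exists_linearIndependent ℂ {v | T v = v}
  have : Finite b := hli.finite
  obtain ⟨r, ⟨e⟩⟩ := Finite.exists_equiv_fin b
  refine ⟨r, fun i ↦ (e.symm i : V), fun i ↦ hb (e.symm i).2, hli.comp _ e.symm.injective, ?_⟩
  have hr : Set.range (fun i ↦ (e.symm i : V)) = b := by
    rw [show (fun i ↦ (e.symm i : V)) = Subtype.val ∘ e.symm from rfl,
      e.symm.surjective.range_comp, Subtype.range_coe]
  rw [hr, hspan]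
  refine le_antisymm (Submodule.span_le.2 fun x hx ↦ ?_) fun x hx ↦
    mem_span_fixedPoints_of_apply_apply_eq T ((hW x).1 hx)
  have hx : T x = x := hx
  exact (hW x).2 (by rw [hx, hx])

theorem eq_zero_of_smul_add_smul_mem {U : Submodule ℂ V} (hU : ∀ x ∈ U, T x ∈ U) {w : V}
    (hw : T (T w) = -w) (hwU : w ∉ U) {a b : ℂ} (h : a • w + b • T w ∈ U) : a = 0 ∧ b = 0 := by
  have h' : conj a • T w - conj b • w ∈ U := by
    simpa [hw, sub_eq_add_neg] using hU _ h
  have key : (a * conj a + b * conj b) • w ∈ U := by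
    have := sub_mem (U.smul_mem (conj a) h) (U.smul_mem b h')
    convert this using 1
    module
  have hab : a * conj a + b * conj b = 0 := by
    by_contra h0
    exact hwU ((U.smul_mem_iff h0).1 key)
  rw [Complex.mul_conj, Complex.mul_conj, ← Complex.ofReal_add, Complex.ofReal_eq_zero] at hab
  have ha := Complex.normSq_nonneg a
  have hb := Complex.normSq_nonneg b
  exact ⟨Complex.normSq_eq_zero.1 (by linarith), Complex.normSq_eq_zero.1 (by linarith)⟩

theorem exists_linearIndependent_quaternionic [FiniteDimensional ℂ V] (W : Submodule ℂ V)
    (hW : ∀ x, x ∈ W ↔ T (T x) = -x) :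
    ∃ (r : ℕ) (v : Fin r → V), (∀ i, T (T (v i)) = -v i) ∧
      LinearIndependent ℂ (Sum.elim v (T ∘ v)) ∧
      Submodule.span ℂ (Set.range (Sum.elim v (T ∘ v))) = W := by
  classical
  let p : ℕ → Prop := fun r ↦ ∃ v : Fin r → V, (∀ i, T (T (v i)) = -v i) ∧
    LinearIndependent ℂ (Sum.elim v (T ∘ v))
  have hp0 : p 0 := ⟨Fin.elim0, fun i ↦ i.elim0, linearIndependent_empty_type⟩
  have hbound : ∀ r, p r → r ≤ Module.finrank ℂ V := by
    rintro r ⟨v, -, hv⟩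
    have := hv.fintype_card_le_finrank
    simp at this
    omega
  set r := Nat.findGreatest p (Module.finrank ℂ V) with hr
  obtain ⟨v, hv, hli⟩ : p r := Nat.findGreatest_spec (Nat.zero_le _) hp0
  refine ⟨r, v, hv, hli, ?_⟩
  set U := Submodule.span ℂ (Set.range (Sum.elim v (T ∘ v))) with hU
  have hmem : ∀ i, Sum.elim v (T ∘ v) i ∈ U := fun i ↦ Submodule.subset_span ⟨i, rfl⟩
  have hTU : ∀ x ∈ U, T x ∈ U := by
    intro x hx
    induction hx using Submodule.span_induction with
    | mem x hx =>
      obtain ⟨i | i, rfl⟩ := hx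
      · exact hmem (.inr i)
      · simpa [hv] using hmem (.inl i)
    | zero => simp
    | add x y _ _ hx hy => simpa using add_mem hx hy
    | smul a x _ hx => simpa using U.smul_mem _ hx
  refine le_antisymm (Submodule.span_le.2 ?_) fun w hw ↦ ?_
  · rintro _ ⟨i | i, rfl⟩
    · exact (hW _).2 (hv i)
    · exact (hW _).2 (by simp [hv])
  by_contra hwU
  rw [hW] at hw
  have hsucc : p (r + 1) := by
    refine ⟨Fin.cons w v, Fin.cases hw hv, ?_⟩
    rw [Fintype.linearIndependent_iff] at hli ⊢
    intro g hg
    simp only [Fintype.sum_sum_type, Fin.sum_univ_succ, Sum.elim_inl, Sum.elim_inr,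
      Function.comp_apply, Fin.cons_zero, Fin.cons_succ] at hg
    obtain ⟨h₁, h₂⟩ := eq_zero_of_smul_add_smul_mem T hTU hw hwU
      (a := g (.inl 0)) (b := g (.inr 0)) (by
        rw [← neg_mem_iff]
        have : -(g (.inl 0) • w + g (.inr 0) • T w) =
            ∑ i : Fin r, g (.inl i.succ) • v i + ∑ i : Fin r, g (.inr i.succ) • T (v i) := by
          rw [neg_eq_iff_add_eq_zero, ← hg]
          abel
        rw [this]
        exact add_mem (sum_mem fun i _ ↦ U.smul_mem _ (hmem (.inl i)))
          (sum_mem fun i _ ↦ U.smul_mem _ (hmem (.inr i))))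
    have h := hli (Sum.elim (fun i ↦ g (.inl i.succ)) fun i ↦ g (.inr i.succ))
      (by simpa [h₁, h₂] using hg)
    rintro (i | i)
    · exact Fin.cases h₁ (fun j ↦ h (.inl j)) i
    · exact Fin.cases h₂ (fun j ↦ h (.inr j)) i
  have := Nat.le_findGreatest (hbound _ hsucc) hsucc
  omega

theorem exists_basis_real_quaternionic [FiniteDimensional ℂ V]
    (hT : ∀ x, T (T (T (T x))) = x) :
    ∃ (r₁ r₂ : ℕ) (b : Module.Basis (Fin r₁ ⊕ (Fin r₂ ⊕ Fin r₂)) ℂ V),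
      (∀ i, T (b (.inl i)) = b (.inl i)) ∧
      (∀ i, T (b (.inr (.inl i))) = b (.inr (.inr i))) ∧
      ∀ i, T (b (.inr (.inr i))) = -b (.inr (.inl i)) := by
  let S : V →ₗ[ℂ] V := T.comp T
  have hW₁ : ∀ x, x ∈ LinearMap.ker (S - LinearMap.id) ↔ T (T x) = x := fun x ↦ by
    simp [S, sub_eq_zero]
  have hW₂ : ∀ x, x ∈ LinearMap.ker (S + LinearMap.id) ↔ T (T x) = -x := fun x ↦ by
    simp [S, add_eq_zero_iff_eq_neg]
  obtain ⟨r₁, v, hv, hvli, hvs⟩ := exists_linearIndependent_fixed T _ hW₁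
  obtain ⟨r₂, w, hw, hwli, hws⟩ := exists_linearIndependent_quaternionic T _ hW₂
  have hli : LinearIndependent ℂ (Sum.elim v (Sum.elim w (T ∘ w))) := by
    refine hvli.sum_type hwli ?_
    rw [hvs, hws, Submodule.disjoint_def]
    intro x h₁ h₂
    rw [hW₁] at h₁
    rw [hW₂, h₁, eq_neg_iff_add_eq_zero, ← two_smul ℂ x] at h₂
    exact (smul_eq_zero.1 h₂).resolve_left two_ne_zero
  have hspan : ⊤ ≤ Submodule.span ℂ (Set.range (Sum.elim v (Sum.elim w (T ∘ w)))) := by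
    rw [Set.Sum.elim_range, Submodule.span_union, hvs, hws]
    intro x _
    have hx : x = (1 / 2 : ℂ) • (x + T (T x)) + (1 / 2 : ℂ) • (x - T (T x)) := by module
    rw [hx]
    refine add_mem (Submodule.smul_mem _ _ (Submodule.mem_sup_left ((hW₁ _).2 ?_)))
      (Submodule.smul_mem _ _ (Submodule.mem_sup_right ((hW₂ _).2 ?_)))
    · simp [hT, add_comm]
    · simp [hT]
  refine ⟨r₁, r₂, Module.Basis.mk hli hspan, fun i ↦ ?_, fun i ↦ ?_, fun i ↦ ?_⟩
  · simp [hv]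
  · simp
  · simp [hw]

end Antilinear

theorem mul_eq_map_conj_mul_of_mem_adjoin {ι : Type*} [Fintype ι] [DecidableEq ι]
    {M X y : Matrix ι ι ℂ} (hX : M * X = X.map conj * M) (hy : y ∈ Algebra.adjoin ℝ {X}) :
    M * y = y.map conj * M := by
  induction hy using Algebra.adjoin_induction with
  | mem x hx => rwa [Set.mem_singleton_iff.1 hx]
  | algebraMap r =>
    have : (algebraMap ℝ (Matrix ι ι ℂ) r).map conj = algebraMap ℝ (Matrix ι ι ℂ) r := by
      ext i j
      by_cases hij : i = j <;> simp [Matrix.algebraMap_matrix_apply, hij]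
    rw [this, Algebra.commutes]
  | add x y _ _ hx hy => rw [mul_add, hx, hy, Matrix.map_add _ (map_add _), add_mul]
  | mul x y _ _ hx hy => rw [← mul_assoc, hx, mul_assoc, hy, Matrix.map_mul, mul_assoc]

/-- An invertible intertwiner between a family of matrices and its conjugate may be corrected, by
a real polynomial in `conj P * P`, so that the square of the associated antilinear map is an
involution. -/
theorem exists_intertwiner_conj_mul_self_sq_eq_one {ι : Type*} [Fintype ι] [DecidableEq ι]
    (P : Matrix ι ι ℂ) (hP : IsUnit P) :
    ∃ M : Matrix ι ι ℂ, IsUnit M ∧ (M.map conj * M) ^ 2 = 1 ∧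
      ∀ A : Matrix ι ι ℂ, P * A = A.map conj * P → M * A = A.map conj * M := by
  have hPc : IsUnit (P.map conj) := hP.map (starRingEnd ℂ).mapMatrix
  have hcc : ∀ A : Matrix ι ι ℂ, (A.map conj).map conj = A := fun A ↦ by ext; simp
  set X := P.map conj * P with hX
  have hXu : IsUnit X := hPc.mul hP
  obtain ⟨b, hb, hb4⟩ := exists_mem_adjoin_pow_four_eq_sq X hXu
  have hbu : IsUnit b := (isUnit_pow_iff four_ne_zero).1 (hb4 ▸ hXu.pow 2)
  obtain ⟨b, rfl⟩ := hbu
  have hPX : P * X = X.map conj * P := by rw [hX, Matrix.map_mul, hcc, mul_assoc]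
  have hPb : P * b = (b : Matrix ι ι ℂ).map conj * P := mul_eq_map_conj_mul_of_mem_adjoin hPX hb
  have hcomm : ∀ A : Matrix ι ι ℂ, Commute A X → Commute A b := fun A hA ↦
    Algebra.commute_of_mem_adjoin_singleton_of_commute hb hA
  have hXb : Commute X (b⁻¹ : (Matrix ι ι ℂ)ˣ) := (hcomm X (Commute.refl X)).units_inv_right
  refine ⟨P * (b⁻¹ : (Matrix ι ι ℂ)ˣ), hP.mul (Units.isUnit _), ?_, fun A hA ↦ ?_⟩
  · have hbinv : ((b⁻¹ : (Matrix ι ι ℂ)ˣ) : Matrix ι ι ℂ).map conj * P =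
        P * (b⁻¹ : (Matrix ι ι ℂ)ˣ) := by
      rw [Units.eq_mul_inv_iff_mul_eq, mul_assoc, hPb, ← mul_assoc, ← Matrix.map_mul,
        Units.inv_mul, Matrix.map_one _ (map_zero _) (map_one _), one_mul]
    have h : (P * (b⁻¹ : (Matrix ι ι ℂ)ˣ)).map conj * (P * (b⁻¹ : (Matrix ι ι ℂ)ˣ)) =
        X * ((b⁻¹ : (Matrix ι ι ℂ)ˣ) : Matrix ι ι ℂ) ^ 2 := by
      rw [Matrix.map_mul, mul_assoc, ← mul_assoc _ P, hbinv, hX, sq]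
      simp only [mul_assoc]
    rw [h, (hXb.pow_right 2).mul_pow, ← hb4, ← pow_mul]
    rw [← Units.val_pow_eq_pow_val, ← Units.val_pow_eq_pow_val, ← Units.val_mul, inv_pow,
      mul_inv_cancel, Units.val_one]
  · have hA' : P.map conj * A.map conj = A * P.map conj := by
      rw [← Matrix.map_mul, hA, Matrix.map_mul, hcc]
    have hAX : Commute A X := by
      rw [commute_iff_eq, hX, mul_assoc, hA, ← mul_assoc, ← mul_assoc, hA']
    have := (hcomm A hAX).units_inv_right
    rw [mul_assoc, ← this.eq, ← mul_assoc, hA, mul_assoc]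

/-- The antilinear map `x ↦ conj (M x)`. -/
def conjMulVec {ι : Type*} [Fintype ι] (M : Matrix ι ι ℂ) :
    (ι → ℂ) →ₛₗ[starRingEnd ℂ] (ι → ℂ) where
  toFun x := star (M *ᵥ x)
  map_add' x y := by rw [mulVec_add, star_add]
  map_smul' a x := by rw [mulVec_smul, star_smul]; rfl

theorem conjMulVec_apply {ι : Type*} [Fintype ι] (M : Matrix ι ι ℂ) (x : ι → ℂ) :
    conjMulVec M x = star (M *ᵥ x) := rfl

theorem conjMulVec_conjMulVec {ι : Type*} [Fintype ι] (M : Matrix ι ι ℂ) (x : ι → ℂ) :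
    conjMulVec M (conjMulVec M x) = (M.map conj * M) *ᵥ x := by
  have h : ∀ y : ι → ℂ, star (M *ᵥ star y) = M.map conj *ᵥ y := fun y ↦ by
    ext i
    simp [mulVec, dotProduct]
  rw [conjMulVec_apply, conjMulVec_apply, h, mulVec_mulVec]

/-- The matrix, over `ℂʳ ⊕ ℂ²ᵐ`, of the antilinear map which is the standard conjugation on the
first summand and the standard quaternionic structure on the second. -/
def structureMatrix (r m : ℕ) :
    Matrix (Fin r ⊕ (Fin m ⊕ Fin m)) (Fin r ⊕ (Fin m ⊕ Fin m)) ℂ :=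
  fromBlocks 1 0 0 (-Jmat m)

theorem Jmat_mul_self (m : ℕ) : Jmat m * Jmat m = -1 := by
  rw [Jmat, fromBlocks_multiply, ← fromBlocks_one, fromBlocks_neg]
  simp

theorem map_conj_Jmat (m : ℕ) : (Jmat m).map conj = Jmat m := by
  ext (i | i) (j | j) <;> simp [Jmat, Matrix.one_apply, apply_ite]

theorem eq_zero_of_self_eq_neg {p q : Type*} {A : Matrix p q ℂ} (h : A = -A) : A = 0 := by
  ext i j
  exact self_eq_neg.1 (congrFun₂ h i j)

theorem eq_fromBlocks_of_structureMatrix_mul_eq {r m : ℕ}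
    {R : Matrix (Fin r ⊕ (Fin m ⊕ Fin m)) (Fin r ⊕ (Fin m ⊕ Fin m)) ℂ}
    (h : structureMatrix r m * R = R.map conj * structureMatrix r m) :
    ∃ (A : Matrix (Fin r) (Fin r) ℝ) (B : Matrix (Fin m ⊕ Fin m) (Fin m ⊕ Fin m) ℂ),
      B * Jmat m = Jmat m * B.map conj ∧ R = fromBlocks (A.map Complex.ofReal) 0 0 B := by
  obtain ⟨a, b, c, d, rfl⟩ : ∃ a b c d, R = fromBlocks a b c d :=
    ⟨_, _, _, _, (fromBlocks_toBlocks R).symm⟩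
  rw [structureMatrix, fromBlocks_map, fromBlocks_multiply, fromBlocks_multiply,
    fromBlocks_inj] at h
  simp only [Matrix.one_mul, Matrix.mul_one, Matrix.zero_mul, Matrix.mul_zero, add_zero, zero_add,
    Matrix.neg_mul, Matrix.mul_neg, neg_inj] at h
  obtain ⟨ha, hb, hc, hd⟩ := h
  have hcc : ∀ {p q : Type} (A : Matrix p q ℂ), (A.map conj).map conj = A := fun A ↦ by
    ext; simp
  have hb0 : b = 0 := by
    have h₁ : b.map conj = -(b * Jmat m) := by
      conv_lhs => rw [hb]
      rw [Matrix.map_neg _ (map_neg _), Matrix.map_mul, hcc, map_conj_Jmat]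
    rw [h₁, Matrix.neg_mul, neg_neg, Matrix.mul_assoc, Jmat_mul_self, Matrix.mul_neg,
      Matrix.mul_one] at hb
    exact eq_zero_of_self_eq_neg hb
  have hc0 : c = 0 := by
    have h₁ : c = -(Jmat m * c.map conj) := by
      have := congrArg (fun A ↦ A.map conj) hc
      simp only [hcc] at this
      rw [Matrix.map_neg _ (map_neg _), Matrix.map_mul, map_conj_Jmat] at this
      exact this.symm
    rw [← hc, Matrix.mul_neg, ← Matrix.mul_assoc, Jmat_mul_self, Matrix.neg_mul, Matrix.one_mul,
      neg_neg] at h₁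
    exact eq_zero_of_self_eq_neg h₁
  refine ⟨a.map Complex.re, d, ?_, ?_⟩
  · have := congrArg (fun A ↦ A.map conj) hd
    simp only [Matrix.map_mul, hcc, map_conj_Jmat] at this
    exact this.symm
  · rw [hb0, hc0, fromBlocks_inj]
    refine ⟨?_, rfl, rfl, rfl⟩
    ext i j
    have := congrFun₂ ha i j
    exact (Complex.conj_eq_iff_re.1 this.symm).symm

theorem isUnit_of_isUnit_fromBlocks_ofReal {r : ℕ} {κ : Type*} [Fintype κ] [DecidableEq κ]
    {A : Matrix (Fin r) (Fin r) ℝ} {B : Matrix κ κ ℂ}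
    (h : IsUnit (fromBlocks (A.map Complex.ofReal) 0 0 B)) : IsUnit A ∧ IsUnit B := by
  rw [Matrix.isUnit_fromBlocks_zero₂₁] at h
  refine ⟨?_, h.2⟩
  have hA := h.1
  rw [Matrix.isUnit_iff_isUnit_det, isUnit_iff_ne_zero] at hA ⊢
  intro h0
  refine hA ?_
  have := Complex.ofRealHom.map_det A
  rw [h0, map_zero] at this
  exact this.symm

theorem exists_conjMulVec_normal_form {n : ℕ} (M : Matrix (Fin n) (Fin n) ℂ)
    (hM : (M.map conj * M) ^ 2 = 1) :
    ∃ (r₁ r₂ : ℕ) (e : Fin r₁ ⊕ (Fin r₂ ⊕ Fin r₂) ≃ Fin n) (C : Matrix (Fin n) (Fin n) ℂ),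
      IsUnit C ∧ M * C = C.map conj * reindex e e (structureMatrix r₁ r₂) := by
  obtain ⟨r₁, r₂, b, h₁, h₂, h₃⟩ := exists_basis_real_quaternionic (conjMulVec M) fun x ↦ by
    rw [conjMulVec_conjMulVec, conjMulVec_conjMulVec, mulVec_mulVec, ← sq, hM, one_mulVec]
  let e : Fin r₁ ⊕ (Fin r₂ ⊕ Fin r₂) ≃ Fin n := b.indexEquiv (Pi.basisFun ℂ (Fin n))
  let C : Matrix (Fin n) (Fin n) ℂ := of fun i j ↦ b (e.symm j) i
  refine ⟨r₁, r₂, e, C, ?_, ?_⟩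
  · rw [← Matrix.linearIndependent_cols_iff_isUnit]
    exact b.linearIndependent.comp _ e.symm.injective
  · have hcol : ∀ i k, (M * C) i (e k) = conj (conjMulVec M (b k) i) := fun i k ↦ by
      simp [conjMulVec_apply, Matrix.mul_apply, mulVec, dotProduct, C]
    ext i j
    obtain ⟨k, rfl⟩ := e.surjective j
    have hsum : (C.map conj * reindex e e (structureMatrix r₁ r₂)) i (e k) =
        ∑ l, conj (b l i) * structureMatrix r₁ r₂ l k := by
      rw [Matrix.mul_apply, ← e.sum_comp]
      simp [C]
    rw [hcol, hsum]
    rcases k with k | k | k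
    · simp [h₁, structureMatrix, Matrix.one_apply]
    · simp [h₂, structureMatrix, Jmat, Matrix.one_apply]
    · simp [h₃, structureMatrix, Jmat, Matrix.one_apply]

end

theorem stmt18 {Γ : Type*} [Group Γ] {n : ℕ} (hn : 0 < n)
    (ρ : Γ →* Matrix.GeneralLinearGroup (Fin n) ℂ)
    (hss : MatSemisimple ρ)
    (P : Matrix (Fin n) (Fin n) ℂ) (hP : IsUnit P)
    (hconj : ∀ γ : Γ, P * (ρ γ : Matrix (Fin n) (Fin n) ℂ) * P⁻¹
        = (ρ γ : Matrix (Fin n) (Fin n) ℂ).map (starRingEnd ℂ)) :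
    ∃ r₁ r₂ : ℕ, r₁ + 2 * r₂ = n ∧
      ∃ Q : Matrix (Fin n) (Fin n) ℂ, IsUnit Q ∧
        ∃ e : Fin r₁ ⊕ (Fin r₂ ⊕ Fin r₂) ≃ Fin n,
          ∀ γ : Γ,
            ∃ (A : Matrix (Fin r₁) (Fin r₁) ℝ)
              (B : Matrix (Fin r₂ ⊕ Fin r₂) (Fin r₂ ⊕ Fin r₂) ℂ),
              IsUnit A ∧ IsUnit B ∧
              B * Jmat r₂ = Jmat r₂ * B.map (starRingEnd ℂ) ∧
              Q * (ρ γ : Matrix (Fin n) (Fin n) ℂ) * Q⁻¹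
                = Matrix.reindex e e
                    (Matrix.fromBlocks (A.map (Complex.ofReal)) 0 0 B) := by
  obtain ⟨M, -, hM, hPM⟩ := exists_intertwiner_conj_mul_self_sq_eq_one P hP
  obtain ⟨r₁, r₂, e, C, hC, hMC⟩ := exists_conjMulVec_normal_form M hM
  have hCdet := (Matrix.isUnit_iff_isUnit_det C).1 hC
  have hPdet := (Matrix.isUnit_iff_isUnit_det P).1 hP
  have hCc : IsUnit (C.map (starRingEnd ℂ)) := hC.map (starRingEnd ℂ).mapMatrix
  refine ⟨r₁, r₂, ?_, C⁻¹, Matrix.isUnit_nonsing_inv_iff.2 hC, e, fun γ ↦ ?_⟩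
  · have := Fintype.card_congr e
    simp only [Fintype.card_sum, Fintype.card_fin] at this
    omega
  have hM' : M * (ρ γ : Matrix (Fin n) (Fin n) ℂ) =
      (ρ γ : Matrix (Fin n) (Fin n) ℂ).map (starRingEnd ℂ) * M :=
    hPM _ (by rw [← hconj γ, Matrix.nonsing_inv_mul_cancel_right _ _ hPdet])
  rw [Matrix.nonsing_inv_nonsing_inv _ hCdet]
  set R := C⁻¹ * (ρ γ : Matrix (Fin n) (Fin n) ℂ) * C with hR
  have hRu : IsUnit R :=
    ((Matrix.isUnit_nonsing_inv_iff.2 hC).mul (ρ γ).isUnit).mul hC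
  have hCR : C * R = (ρ γ : Matrix (Fin n) (Fin n) ℂ) * C := by
    rw [hR, mul_assoc C⁻¹, Matrix.mul_nonsing_inv_cancel_left _ _ hCdet]
  have hDR : reindex e e (structureMatrix r₁ r₂) * R =
      R.map (starRingEnd ℂ) * reindex e e (structureMatrix r₁ r₂) := by
    refine hCc.mul_left_cancel ?_
    rw [← mul_assoc, ← hMC, mul_assoc, hCR, ← mul_assoc, hM', mul_assoc, hMC, ← mul_assoc,
      ← mul_assoc, ← Matrix.map_mul, ← Matrix.map_mul, hCR]
  obtain ⟨S, hS⟩ : ∃ S, R = reindex e e S := ⟨_, ((reindex e e).apply_symm_apply R).symm⟩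
  rw [hS] at hDR hRu ⊢
  have hDS : structureMatrix r₁ r₂ * S = S.map (starRingEnd ℂ) * structureMatrix r₁ r₂ := by
    refine (reindex e e).injective ?_
    simpa only [reindex_apply, ← submatrix_map, submatrix_mul_equiv] using hDR
  obtain ⟨A, B, hB, rfl⟩ := eq_fromBlocks_of_structureMatrix_mul_eq hDS
  rw [reindex_apply, Matrix.isUnit_submatrix_equiv] at hRu
  obtain ⟨hA, hBu⟩ := isUnit_of_isUnit_fromBlocks_ofReal hRu
  exact ⟨A, B, hA, hBu, hB, rfl⟩
end
end
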